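/- Let X be a normed vector space over ℝ or ℂ and T : X → X a bounded linear operator that is chain transitive and has the positive shadowing property. Then T is topologically mixing: for any pair of non-empty open sets U, V ⊆ X there is N ∈ ℕ such that for every n > N one has T^n(U) ∩ V ≠ ∅. -/

import Mathlib

/-- An `ε`-chain of `T` from `x` to `y`: a finite sequence `x = c 0, c 1, …, c n = y`
with `n ≥ 1` such that `‖T (c i) - c (i+1)‖ < ε` for every `0 ≤ i < n`. -/
def EpsChain {E : Type*} [NormedAddCommGroup E] (T : E → E) (ε : ℝ) (x y : E) : Prop :=
  ∃ (n : ℕ) (c : ℕ → E), 1 ≤ n ∧ c 0 = x ∧ c n = y ∧ ∀ i < n, ‖T (c i) - c (i + 1)‖ < ε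

/-- `x` is a chain recurrent point of `T` if for every `ε > 0` there is an `ε`-chain
beginning and ending at `x`. -/
def ChainRecurrent {E : Type*} [NormedAddCommGroup E] (T : E → E) (x : E) : Prop :=
  ∀ ε > 0, EpsChain T ε x x

/-- `T` has the positive shadowing property: for every `ε > 0` there is `δ > 0` such
that every positive `δ`-pseudo orbit `(x n)` (i.e. `‖T (x n) - x (n+1)‖ ≤ δ` for all `n`)
is `ε`-shadowed by some `z`, i.e. `‖x n - T^[n] z‖ < ε` for all `n`. -/
def PosShadowing {E : Type*} [NormedAddCommGroup E] (T : E → E) : Prop :=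
  ∀ ε > 0, ∃ δ > 0, ∀ x : ℕ → E, (∀ n : ℕ, ‖T (x n) - x (n + 1)‖ ≤ δ) →
    ∃ z : E, ∀ n : ℕ, ‖x n - T^[n] z‖ < ε

/-- Two sequences with `c m = d 0` can be glued into one. -/
lemma exists_seq_glue {E : Type*} (c d : ℕ → E) (m : ℕ) (h : c m = d 0) :
    ∃ g : ℕ → E, (∀ i ≤ m, g i = c i) ∧ ∀ j, g (m + j) = d j := by
  refine ⟨fun i => if i ≤ m then c i else d (i - m), fun i hi => by simp [hi], fun j => ?_⟩
  rcases Nat.eq_zero_or_pos j with rfl | hj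
  · simpa using h
  · have : ¬ m + j ≤ m := by omega
    simp [this]

/-- There is an `ε`-chain of `T` from `x` to `y` with exactly `n` steps. -/
def EpsChainOfLength {E : Type*} [NormedAddCommGroup E] (T : E → E) (ε : ℝ) (n : ℕ)
    (x y : E) : Prop :=
  ∃ c : ℕ → E, c 0 = x ∧ c n = y ∧ ∀ i < n, ‖T (c i) - c (i + 1)‖ < ε

section

variable {E : Type*} [NormedAddCommGroup E] {T : E → E} {ε : ℝ} {x y z : E}

lemma epsChain_iff_exists_length :
    EpsChain T ε x y ↔ ∃ n, 1 ≤ n ∧ EpsChainOfLength T ε n x y := by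
  constructor
  · rintro ⟨n, c, hn, h⟩
    exact ⟨n, hn, c, h⟩
  · rintro ⟨n, hn, c, h⟩
    exact ⟨n, c, hn, h⟩

lemma EpsChainOfLength.trans {m n : ℕ} (hxy : EpsChainOfLength T ε m x y)
    (hyz : EpsChainOfLength T ε n y z) : EpsChainOfLength T ε (m + n) x z := by
  obtain ⟨c, hc0, hcm, hc⟩ := hxy
  obtain ⟨d, hd0, hdn, hd⟩ := hyz
  obtain ⟨g, hg₁, hg₂⟩ := exists_seq_glue c d m (hcm.trans hd0.symm)
  refine ⟨g, by rw [hg₁ 0 m.zero_le, hc0], by rw [hg₂, hdn], fun i hi => ?_⟩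
  rcases lt_or_ge i m with him | him
  · rw [hg₁ i him.le, hg₁ (i + 1) him]
    exact hc i him
  · obtain ⟨j, rfl⟩ := Nat.exists_eq_add_of_le him
    rw [add_assoc, hg₂, hg₂]
    exact hd j (by omega)

lemma EpsChain.trans (hxy : EpsChain T ε x y) (hyz : EpsChain T ε y z) : EpsChain T ε x z := by
  rw [epsChain_iff_exists_length] at *
  obtain ⟨m, hm, hc⟩ := hxy
  obtain ⟨n, -, hd⟩ := hyz
  exact ⟨m + n, by omega, hc.trans hd⟩

/-- A chain recurrent point can be joined to nearby points. -/
lemma ChainRecurrent.epsChain_of_norm_sub_lt (hx : ChainRecurrent T x) (hε : 0 < ε)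
    (hxy : ‖x - y‖ < ε / 2) : EpsChain T ε x y := by
  obtain ⟨n, c, hn, hc0, hcn, hc⟩ := hx (ε / 2) (half_pos hε)
  refine ⟨n, Function.update c n y, hn, ?_, by simp, fun i hi => ?_⟩
  · rw [Function.update_of_ne (by omega), hc0]
  · rw [Function.update_of_ne hi.ne]
    rcases eq_or_ne (i + 1) n with rfl | hne
    · rw [Function.update_self]
      have h := hc i hi
      rw [hcn] at h
      linarith [norm_sub_le_norm_sub_add_norm_sub (T (c i)) x y]
    · rw [Function.update_of_ne hne]
      linarith [hc i hi]

lemma epsChainOfLength_of_fixed (hx : T x = x) (hε : 0 < ε) (n : ℕ) :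
    EpsChainOfLength T ε n x x :=
  ⟨fun _ => x, rfl, rfl, fun _ _ => by simpa [hx] using hε⟩

/-- Under positive shadowing, every sufficiently fine chain is followed by a true orbit. -/
lemma PosShadowing.exists_orbit (hT : PosShadowing T) (hε : 0 < ε) :
    ∃ δ > 0, ∀ n x y, EpsChainOfLength T δ n x y →
      ∃ z, ‖x - z‖ < ε ∧ ‖y - T^[n] z‖ < ε := by
  obtain ⟨δ, hδ, H⟩ := hT ε hε
  refine ⟨δ, hδ, ?_⟩
  rintro n x y ⟨c, hc0, hcn, hc⟩
  obtain ⟨g, hg₁, hg₂⟩ := exists_seq_glue c (fun j => T^[j] y) n hcn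
  obtain ⟨z, hz⟩ := H g fun i => by
    rcases lt_or_ge i n with hin | hin
    · rw [hg₁ i hin.le, hg₁ (i + 1) hin]
      exact (hc i hin).le
    · obtain ⟨j, rfl⟩ := Nat.exists_eq_add_of_le hin
      rw [add_assoc, hg₂, hg₂, Function.iterate_succ_apply', sub_self, norm_zero]
      exact hδ.le
  refine ⟨z, ?_, ?_⟩
  · simpa [hg₁ 0 n.zero_le, hc0] using hz 0
  · simpa [hg₁ n le_rfl, hcn] using hz n

/-- If every point is chain recurrent, each point can be joined to the origin and back. -/
lemma epsChain_zero_of_chainRecurrent (𝕜 : Type*) [RCLike 𝕜] [NormedSpace 𝕜 E]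
    (hT : ∀ x, ChainRecurrent T x) (hε : 0 < ε) (x : E) :
    EpsChain T ε 0 x ∧ EpsChain T ε x 0 := by
  have multiples (w : E) (hw : ‖w‖ < ε / 2) (k : ℕ) :
      EpsChain T ε 0 (k • w) ∧ EpsChain T ε (k • w) 0 := by
    induction k with
    | zero => simpa using hT 0 ε hε
    | succ k ih =>
      exact ⟨ih.1.trans ((hT _).epsChain_of_norm_sub_lt hε (by simpa [succ_nsmul] using hw)),
        ((hT _).epsChain_of_norm_sub_lt hε (by simpa [succ_nsmul] using hw)).trans ih.2⟩
  obtain ⟨n, hn⟩ := exists_nat_gt (‖x‖ / (ε / 2))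
  have hn0 : (0 : ℝ) < n := lt_of_le_of_lt (by positivity) hn
  have hn0' : (n : 𝕜) ≠ 0 := by
    have : n ≠ 0 := by rintro rfl; simp at hn0
    exact_mod_cast this
  have h := multiples ((n : 𝕜)⁻¹ • x) (by
    rw [norm_smul, norm_inv, RCLike.norm_natCast, inv_mul_lt_iff₀ hn0]
    exact (div_lt_iff₀ (half_pos hε)).1 hn) n
  rwa [← Nat.cast_smul_eq_nsmul 𝕜, smul_inv_smul₀ hn0'] at h

end

theorem stmt_14 {𝕜 : Type*} [RCLike 𝕜] {X : Type*} [NormedAddCommGroup X]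
    [NormedSpace 𝕜 X] (T : X →L[𝕜] X)
    (hct : ∀ x : X, ChainRecurrent (⇑T) x) (hsh : PosShadowing (⇑T)) :
    ∀ U V : Set X, IsOpen U → IsOpen V → U.Nonempty → V.Nonempty →
      ∃ N : ℕ, ∀ n > N, ((⇑T)^[n] '' U ∩ V).Nonempty := by
  rintro U V hU hV ⟨u, hu⟩ ⟨v, hv⟩
  obtain ⟨r, hr, hrU⟩ := Metric.isOpen_iff.1 hU u hu
  obtain ⟨s, hs, hsV⟩ := Metric.isOpen_iff.1 hV v hv
  obtain ⟨δ, hδ, H⟩ := hsh.exists_orbit (lt_min hr hs)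
  obtain ⟨m, -, hm⟩ :=
    epsChain_iff_exists_length.1 (epsChain_zero_of_chainRecurrent 𝕜 hct hδ u).2
  obtain ⟨l, -, hl⟩ :=
    epsChain_iff_exists_length.1 (epsChain_zero_of_chainRecurrent 𝕜 hct hδ v).1
  refine ⟨m + l, fun n hn => ?_⟩
  obtain ⟨k, rfl⟩ := Nat.exists_eq_add_of_lt hn
  have chain := (hm.trans (epsChainOfLength_of_fixed (map_zero T) hδ (k + 1))).trans hl
  rw [show m + (k + 1) + l = m + l + k + 1 by omega] at chain
  obtain ⟨z, hz₁, hz₂⟩ := H _ u v chain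
  refine ⟨_, ⟨z, hrU ?_, rfl⟩, hsV ?_⟩
  · rw [Metric.mem_ball, dist_comm, dist_eq_norm]
    exact hz₁.trans_le (min_le_left _ _)
  · rw [Metric.mem_ball, dist_comm, dist_eq_norm]
    exact hz₂.trans_le (min_le_right _ _)
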